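/- Let R be a commutative ring which is a finite localization of ℤ, and let M be a bounded complex of finitely generated modules over a finitely generated flat R-algebra A. If for every prime q of ℤ not invertible in R, the derived base change M ⊗^L_R 𝔽̄_q is concentrated in degree 0, then each cohomology module of M vanishes outside degree 0 and H⁰(M) is flat over R. -/

import Mathlib

open CategoryTheory Limits

theorem aux_jac : IsJacobsonRing ℤ := by
  rw [isJacobsonRing_iff_prime_eq]
  intro P hP
  by_cases h : P = ⊥
  · subst h
    refine le_antisymm (fun x hx => ?_) Ideal.le_jacobson
    rw [Ideal.mem_jacobson_bot] at hx
    have := hx (3 * x)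
    rw [Int.isUnit_iff] at this
    have hx0 : x = 0 := by
      rcases this with h | h <;> nlinarith [sq_nonneg x]
    simp [hx0]
  · have := hP.isMaximal h
    exact Ideal.jacobson_eq_self_of_isMaximal

theorem aux_retract (R : Type) [CommRing R] (S : Submonoid ℤ) [IsLocalization S R]
    (q : ℕ) (hq : q.Prime) (k : Type) [Field k] [CharP k q] [Algebra R k] :
    ∃ r : k →ₗ[R] R ⧸ Ideal.span {(q : R)}, r 1 = 1 := by
  have := Fact.mk hq
  let := ZMod.algebra k q
  obtain ⟨r0, hr0⟩ := LinearMap.exists_leftInverse_of_injective (Algebra.linearMap (ZMod q) k)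
    (LinearMap.ker_eq_bot.2 (algebraMap (ZMod q) k).injective)
  have hc : ((q : ℕ) : R ⧸ Ideal.span {(q : R)}) = 0 := by
    have : (Ideal.Quotient.mk (Ideal.span {(q : R)}) (q : R)) = 0 :=
      Ideal.Quotient.eq_zero_iff_mem.2 (Ideal.mem_span_singleton_self _)
    simpa using this
  let f : {f : ℤ →+ R ⧸ Ideal.span {(q : R)} // f q = 0} :=
    ⟨(Int.castRingHom _).toAddMonoidHom, by simpa using hc⟩
  let g : ZMod q →+ R ⧸ Ideal.span {(q : R)} := ZMod.lift q f
  have hg : g 1 = 1 := by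
    have h1 : ZMod.lift q f ((1 : ℤ) : ZMod q) = f.1 1 := ZMod.lift_coe q f 1
    rw [Int.cast_one] at h1
    exact h1.trans Int.cast_one
  let r1 : k →ₗ[ℤ] R ⧸ Ideal.span {(q : R)} :=
    (g.comp r0.toAddMonoidHom).toIntLinearMap
  have hcomp := IsLocalization.linearMap_compatibleSMul S R k (R ⧸ Ideal.span {(q : R)})
  refine ⟨{ r1 with map_smul' := fun c x => hcomp.map_smul r1 c x }, ?_⟩
  have h1 : r0 1 = 1 := by simpa using LinearMap.congr_fun hr0 1
  change g (r0 1) = 1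
  rw [h1, hg]

open TensorProduct in
theorem aux_exact (R : Type) [CommRing R] (S : Submonoid ℤ) [IsLocalization S R]
    (q : ℕ) (hq : q.Prime) (k : Type) [Field k] [CharP k q] [Algebra R k]
    (P : CochainComplex (ModuleCat.{0} R) ℤ) (i j l : ℤ) (hij : i + 1 = j) (hjl : j + 1 = l)
    (h : IsZero ((((ModuleCat.extendScalars (algebraMap R k)).mapHomologicalComplex
          (ComplexShape.up ℤ)).obj P).homology j))
    (x : P.X j) (z : P.X l) (hx : P.d j l x = (q : R) • z) :
    ∃ (y : P.X i) (w : P.X j), x = P.d i j y + (q : R) • w := by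
  rw [← HomologicalComplex.exactAt_iff_isZero_homology,
    HomologicalComplex.exactAt_iff' _ i j l (by simp; omega) (by simp; omega),
    ShortComplex.moduleCat_exact_iff] at h
  obtain ⟨r, hr⟩ := aux_retract R S q hq k
  have hsm (a : R) (b : k) : r (algebraMap R k a * b) = a • r b := by
    rw [← Algebra.smul_def, map_smul]
  let K : ModuleCat R := (ModuleCat.restrictScalars (algebraMap R k)).obj (ModuleCat.of k k)
  let r' : K →ₗ[R] R ⧸ Ideal.span {(q : R)} :=
    { toFun := fun c => r c
      map_add' := fun a b => r.map_add a b
      map_smul' := fun a b => by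
        exact hsm a b }
  let one : K := (1 : k)
  obtain ⟨t, ht⟩ := h ((one ⊗ₜ[R] x : K ⊗[R] P.X j)) (by
    change (one ⊗ₜ[R] (P.d j l x) : K ⊗[R] P.X l) = 0
    rw [hx, ← TensorProduct.smul_tmul]
    have : (q : R) • one = 0 := by
      change algebraMap R k q * (1 : k) = 0
      simp
    rw [this, TensorProduct.zero_tmul])
  change K ⊗[R] P.X i at t
  replace ht : (LinearMap.lTensor K (P.d i j).hom) t = one ⊗ₜ[R] x := ht
  have h2 := congrArg (LinearMap.rTensor (P.X j) r') ht
  rw [← LinearMap.comp_apply, LinearMap.rTensor_comp_lTensor, ← LinearMap.lTensor_comp_rTensor,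
    LinearMap.comp_apply, LinearMap.rTensor_tmul] at h2
  have hone : r' one = 1 := hr
  rw [hone] at h2
  obtain ⟨y, hy⟩ : ∃ y : P.X i, (LinearMap.rTensor (P.X i) r') t = 1 ⊗ₜ[R] y := by
    generalize (LinearMap.rTensor (P.X i) r') t = s
    induction s with
    | zero => exact ⟨0, by simp⟩
    | add a b ha hb =>
      obtain ⟨u, rfl⟩ := ha
      obtain ⟨v, rfl⟩ := hb
      exact ⟨u + v, by rw [TensorProduct.tmul_add]⟩
    | tmul a b =>
      obtain ⟨a, rfl⟩ := Ideal.Quotient.mk_surjective a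
      refine ⟨a • b, ?_⟩
      rw [← TensorProduct.smul_tmul]
      congr 1
      rw [← mul_one (Ideal.Quotient.mk _ a)]
      rfl
  rw [hy, LinearMap.lTensor_tmul] at h2
  have h3 := congrArg (TensorProduct.quotTensorEquivQuotSMul (P.X j) (Ideal.span {(q : R)})) h2
  have e (u : P.X j) : (TensorProduct.quotTensorEquivQuotSMul (P.X j) (Ideal.span {(q : R)}))
     ((1 : R ⧸ Ideal.span {(q : R)}) ⊗ₜ[R] u) = Submodule.Quotient.mk u := by
    have := TensorProduct.quotTensorEquivQuotSMul_mk_tmul (Ideal.span {(q : R)}) (1 : R) u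
    simpa using this
  rw [e, e, eq_comm, Submodule.Quotient.eq, Submodule.ideal_span_singleton_smul] at h3
  obtain ⟨w, -, hw⟩ := h3
  refine ⟨y, w, ?_⟩
  have hw' : (q : R) • w = x - P.d i j y := hw
  rw [hw']; abel

theorem aux_surj (R : Type) [CommRing R] (q : R)
    (P : CochainComplex (ModuleCat.{0} R) ℤ) (i j l : ℤ) (hjl : j + 1 = l)
    (hreg : ∀ i, IsSMulRegular (P.X i) q)
    (H : ∀ (x : P.X j) (z : P.X l) (_ : P.d j l x = q • z),
      ∃ (y : P.X i) (w : P.X j), x = P.d i j y + q • w) (h : P.homology j) :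
    ∃ h', h = q • h' := by
  have hs : Function.Surjective (P.homologyπ j) := (ModuleCat.epi_iff_surjective _).1 inferInstance
  have hi : Function.Injective (P.iCycles j) := (ModuleCat.mono_iff_injective _).1 inferInstance
  obtain ⟨c, rfl⟩ := hs h
  have hdc : P.d j l (P.iCycles j c) = 0 := by
    rw [← ModuleCat.comp_apply, P.iCycles_d]; rfl
  obtain ⟨y, w, hyw⟩ := H (P.iCycles j c) 0 (by rw [hdc, smul_zero])
  have hdd : P.d j l (P.d i j y) = 0 := by
    rw [← ModuleCat.comp_apply, P.d_comp_d]; rfl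
  have hw : P.d j l w = 0 := by
    apply hreg l
    change q • _ = q • _
    rw [smul_zero, ← map_smul, ← hdc, hyw, map_add, hdd, zero_add]
  have hex := (ShortComplex.moduleCat_exact_iff _).1
    (P.cyclesIsKernel j l (by simp; omega) |> fun hk => ShortComplex.exact_of_f_is_kernel
      (ShortComplex.mk (P.iCycles j) (P.d j l) (P.iCycles_d j l)) hk)
  obtain ⟨w', hw'⟩ := hex w hw
  refine ⟨P.homologyπ j w', ?_⟩
  have : c = P.toCycles i j y + q • w' := by
    apply hi
    rw [map_add, map_smul, ← ModuleCat.comp_apply, P.toCycles_i]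
    rw [hyw]
    congr 2
    exact hw'.symm
  rw [this, map_add, map_smul, ← ModuleCat.comp_apply, P.toCycles_comp_homologyπ]
  exact zero_add _

theorem aux_inj (R : Type) [CommRing R] (q : R)
    (P : CochainComplex (ModuleCat.{0} R) ℤ) (i j l : ℤ) (hjl : j + 1 = l)
    (hreg : ∀ i, IsSMulRegular (P.X i) q)
    (H : ∀ (x : P.X j) (z : P.X l) (_ : P.d j l x = q • z),
      ∃ (y : P.X i) (w : P.X j), x = P.d i j y + q • w) (h : P.homology l)
    (hh : q • h = 0) : h = 0 := by
  have hs : Function.Surjective (P.homologyπ l) := (ModuleCat.epi_iff_surjective _).1 inferInstance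
  have hi : Function.Injective (P.iCycles l) := (ModuleCat.mono_iff_injective _).1 inferInstance
  have hex := (ShortComplex.moduleCat_exact_iff _).1
    (P.homologyIsCokernel j l (by simp; omega) |> fun hk => ShortComplex.exact_of_g_is_cokernel
      (ShortComplex.mk (P.toCycles j l) (P.homologyπ l) (P.toCycles_comp_homologyπ j l)) hk)
  obtain ⟨c, rfl⟩ := hs h
  rw [← map_smul] at hh
  obtain ⟨u, hu⟩ := hex _ hh
  change P.toCycles j l u = q • c at hu
  have hu2 : P.d j l u = q • (P.iCycles l c) := by
    rw [← map_smul, ← hu, ← ModuleCat.comp_apply, P.toCycles_i]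
  obtain ⟨y, w, hyw⟩ := H u _ hu2
  have hdd : P.d j l (P.d i j y) = 0 := by
    rw [← ModuleCat.comp_apply, P.d_comp_d]; rfl
  have hc : c = P.toCycles j l w := by
    apply hi
    rw [← ModuleCat.comp_apply, P.toCycles_i]
    apply hreg l
    change q • _ = q • _
    rw [← hu2, hyw, map_add, hdd, zero_add, map_smul]
  rw [hc, ← ModuleCat.comp_apply, P.toCycles_comp_homologyπ]
  rfl

theorem aux_char (A : Type) [CommRing A] (hA : Algebra.FiniteType ℤ A)
    (H : Type) [AddCommGroup H] [Module A H] [Module.Finite A H] [Nontrivial H] :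
    ∃ (m : Ideal A) (_ : m.IsMaximal) (q : ℕ), q.Prime ∧ CharP (A ⧸ m) q ∧
      ¬ ∀ h : H, ∃ h' : H, h = (q : A) • h' := by
  obtain ⟨N, hN⟩ := IsCoatomic.exists_coatom (Submodule A H)
  have hs : IsSimpleModule A (H ⧸ N) := isSimpleModule_iff_isCoatom.2 hN
  obtain ⟨m, hm, ⟨e⟩⟩ := isSimpleModule_iff_quot_maximal.1 hs
  refine ⟨m, hm, ?_⟩
  let := Ideal.Quotient.field m
  have hft : Algebra.FiniteType ℤ (A ⧸ m) := inferInstance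
  have := aux_jac
  have hfin := finite_of_finite_type_of_isJacobsonRing ℤ (A ⧸ m)
  obtain ⟨q, hq⟩ := CharP.exists (A ⧸ m)
  have hq0 : q ≠ 0 := by
    rintro rfl
    have := CharP.charP_to_charZero (A ⧸ m)
    exact Int.not_isField (isField_of_isIntegral_of_isField
      (FaithfulSMul.algebraMap_injective ℤ (A ⧸ m)) (Field.toIsField _))
  refine ⟨q, (CharP.char_is_prime_or_zero (A ⧸ m) q).resolve_right hq0, hq, fun hsur => ?_⟩
  obtain ⟨u, hu⟩ := Submodule.Quotient.mk_surjective N (e.symm 1)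
  obtain ⟨v, rfl⟩ := hsur u
  have h1 : e (Submodule.Quotient.mk ((q : A) • v)) = 1 := by rw [hu, e.apply_symm_apply]
  rw [Submodule.Quotient.mk_smul, map_smul, Algebra.smul_def] at h1
  have : algebraMap A (A ⧸ m) (q : A) = 0 := by
    rw [map_natCast]; exact CharP.cast_eq_zero _ _
  rw [this, zero_mul] at h1
  exact zero_ne_one h1

theorem aux_regular (R : Type) [CommRing R] (S : Submonoid ℤ) [IsLocalization S R]
    (q : ℕ) (hq : q ≠ 0) (X : Type) [AddCommGroup X] [Module R X] [Module.Flat R X] :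
    IsSMulRegular X (q : R) := by
  have h : Module.Flat ℤ X := (Module.flat_iff_of_isLocalization R S X).1 inferInstance
  have h2 := Module.Flat.isSMulRegular_of_nonZeroDivisors (R := ℤ) (M := X) (r := (q : ℤ))
    (by simpa using hq)
  intro x y hxy
  apply h2
  simpa [Nat.cast_smul_eq_nsmul] using hxy

theorem aux_flat (R : Type) [CommRing R] (S : Submonoid ℤ) [IsLocalization S R]
    (X : Type) [AddCommGroup X] [Module R X]
    (h : ∀ q : ℕ, q.Prime → ∀ x : X, (q : R) • x = 0 → x = 0) : Module.Flat R X := by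
  rw [Module.flat_iff_of_isLocalization R S X]
  have key : ∀ n : ℕ, n ≠ 0 → ∀ x : X, n • x = 0 → x = 0 := by
    intro n
    induction n using Nat.recOnMul with
    | zero => simp
    | one => simp
    | prime p hp =>
      intro _ x hx
      exact h p hp x (by rwa [Nat.cast_smul_eq_nsmul])
    | mul a b ha hb =>
      intro hab x hx
      rw [mul_smul] at hx
      exact hb (right_ne_zero_of_mul hab) x (ha (left_ne_zero_of_mul hab) _ hx)
  rw [IsDedekindDomain.flat_iff_torsion_eq_bot, eq_bot_iff]
  rintro x ⟨⟨n, hn⟩, hx⟩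
  change n • x = 0 at hx
  have hn0 : n ≠ 0 := nonZeroDivisors.ne_zero hn
  refine key n.natAbs (by simpa using hn0) x ?_
  rcases Int.natAbs_eq n with h | h
  · rw [h] at hx; simpa using hx
  · rw [h] at hx; simpa using hx

/-!
STATEMENT 4: Let `R` be a finite localization of `ℤ`, `A` a finitely generated flat `R`-algebra,
and `M` a bounded complex of finitely generated `A`-modules.  The derived base change
`M ⊗^L_R k` to an algebraically closed field `k` of characteristic `q` (for `q` a prime not
invertible in `R`; equivalently, `k` an algebraically closed `R`-algebra field of
characteristic `q`) is computed by choosing a complex `P` of flat `R`-modules quasi-isomorphic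
to `M` (as a complex of `R`-modules) and extending scalars degreewise.
If for every such `k` the complex `M ⊗^L_R k` is concentrated in degree `0`, then the
cohomology of `M` vanishes outside degree `0` and `H⁰(M)` is flat over `R`. -/
theorem derived_base_change_concentrated_implies_flat_and_concentrated
    (R : Type) [CommRing R] (Smon : Submonoid ℤ) (hfg : Smon.FG) [IsLocalization Smon R]
    (A : Type) [CommRing A] [Algebra R A] [Module.Flat R A] (hA : Algebra.FiniteType R A)
    (M : CochainComplex (ModuleCat.{0} A) ℤ)
    (hbdd : ∃ a b : ℤ, ∀ i : ℤ, (i < a ∨ b < i) → IsZero (M.X i))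
    (hfin : ∀ i : ℤ, Module.Finite A (M.homology i))
    -- a flat resolution of `M` as a complex of `R`-modules, used to compute `M ⊗^L_R k`
    (P : CochainComplex (ModuleCat.{0} R) ℤ)
    (hPflat : ∀ i : ℤ, Module.Flat R (P.X i))
    (φ : P ⟶ ((ModuleCat.restrictScalars (algebraMap R A)).mapHomologicalComplex
        (ComplexShape.up ℤ)).obj M)
    (hφ : QuasiIso φ)
    -- hypothesis: for every prime q not invertible in R (i.e. every algebraically closed
    -- R-algebra field k of characteristic q), M ⊗^L_R k is concentrated in degree 0
    (hconc : ∀ (q : ℕ), q.Prime → ∀ (k : Type) [Field k] [IsAlgClosed k] [CharP k q]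
      [Algebra R k],
      ∀ i : ℤ, i ≠ 0 →
        IsZero ((((ModuleCat.extendScalars (algebraMap R k)).mapHomologicalComplex
          (ComplexShape.up ℤ)).obj P).homology i)) :
    (∀ i : ℤ, i ≠ 0 → IsZero (M.homology i)) ∧
      Module.Flat R ((ModuleCat.restrictScalars (algebraMap R A)).obj (M.homology 0)) := by
  classical
  have := (Monoid.fg_iff_submonoid_fg Smon).2 hfg
  have hR : Algebra.FiniteType ℤ R := IsLocalization.finiteType_of_monoid_fg Smon R
  have hAZ : Algebra.FiniteType ℤ A := Algebra.FiniteType.trans hR hA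
  let e (i : ℤ) : P.homology i ≅
      (ModuleCat.restrictScalars (algebraMap R A)).obj (M.homology i) :=
    asIso (HomologicalComplex.homologyMap φ i) ≪≫
      (M.sc i).mapHomologyIso (ModuleCat.restrictScalars (algebraMap R A))
  have hreg (q : ℕ) (hq : q.Prime) (i : ℤ) : IsSMulRegular (P.X i) (q : R) := by
    have := hPflat i
    exact aux_regular R Smon q hq.ne_zero (P.X i)
  constructor
  · intro i hi
    by_contra hne
    have hnt : Nontrivial (M.homology i) := by
      by_contra hnt
      rw [not_nontrivial_iff_subsingleton] at hnt
      exact hne (ModuleCat.isZero_of_subsingleton _)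
    have := hfin i
    obtain ⟨m, hm, q, hq, hchar, hns⟩ := aux_char A hAZ (M.homology i)
    let := Ideal.Quotient.field m
    have : CharP (AlgebraicClosure (A ⧸ m)) q :=
      charP_of_injective_algebraMap (algebraMap (A ⧸ m) (AlgebraicClosure (A ⧸ m))).injective q
    apply hns
    intro h
    have hz := hconc q hq (AlgebraicClosure (A ⧸ m)) i hi
    obtain ⟨h', hh'⟩ := aux_surj R (q : R) P (i - 1) i (i + 1) rfl (hreg q hq)
      (aux_exact R Smon q hq (AlgebraicClosure (A ⧸ m)) P (i - 1) i (i + 1) (by omega) rfl hz)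
      ((e i).inv h)
    refine ⟨(e i).hom h', ?_⟩
    have h2 := congrArg (e i).hom hh'
    have hee (y : (ModuleCat.restrictScalars (algebraMap R A)).obj (M.homology i)) :
        (e i).hom ((e i).inv y) = y := by
      rw [← ModuleCat.comp_apply, (e i).inv_hom_id]; rfl
    rw [map_smul] at h2
    replace h2 := (hee h).symm.trans h2
    change h = algebraMap R A q • (e i).hom h' at h2
    rw [map_natCast] at h2
    exact h2
  · apply aux_flat R Smon
    intro q hq x hx
    by_cases hu : IsUnit (q : R)
    · exact hu.smul_eq_zero.1 hx
    obtain ⟨m, hm, hqm⟩ := exists_max_ideal_of_mem_nonunits hu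
    let := Ideal.Quotient.field m
    have hc : CharP (R ⧸ m) q := by
      have h0 : ((q : ℕ) : R ⧸ m) = 0 := by
        rw [← map_natCast (Ideal.Quotient.mk m)]
        exact Ideal.Quotient.eq_zero_iff_mem.2 hqm
      have := Fact.mk hq
      exact (CharP.charP_iff_prime_eq_zero hq).2 h0
    have : CharP (AlgebraicClosure (R ⧸ m)) q :=
      charP_of_injective_algebraMap (algebraMap (R ⧸ m) (AlgebraicClosure (R ⧸ m))).injective q
    have hz := hconc q hq (AlgebraicClosure (R ⧸ m)) (-1) (by decide)
    have h0 := aux_inj R (q : R) P (-2) (-1) 0 rfl (hreg q hq)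
      (aux_exact R Smon q hq (AlgebraicClosure (R ⧸ m)) P (-2) (-1) 0 rfl rfl hz)
      ((e 0).inv x) (by rw [← map_smul, hx, map_zero])
    have h2 := congrArg (e 0).hom h0
    rw [map_zero, ← ModuleCat.comp_apply, (e 0).inv_hom_id] at h2
    exact h2
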